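/- The exterior differentiation operator of a Lie–Rinehart algebra squares to zero: for every q-form ω on L, d(dω) = 0. -/

import Mathlib

open scoped BigOperators

/-- A Lie–Rinehart algebra structure on `L`: `L` is an `A`-module and a Lie ring, with an
`A`-linear anchor `ρ` into the `R`-derivations of `A` that is a Lie ring morphism, satisfying
the Leibniz rule `⁅x, a • y⁆ = a • ⁅x, y⁆ + (ρ x a) • y`. -/
structure LieRinehartPkg (R A L : Type*) [CommRing R] [CommRing A] [Algebra R A]
    [LieRing L] [Module A L] where
  ρ : L →ₗ[A] Derivation R A A
  ρ_bracket : ∀ x y : L, ρ ⁅x, y⁆ = ⁅ρ x, ρ y⁆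
  leibniz : ∀ (x y : L) (a : A), ⁅x, a • y⁆ = a • ⁅x, y⁆ + (ρ x) a • y

/-- `ω : L^q → A` is a differential `q`-form: `A`-multilinear and alternating. -/
def IsForm {A L : Type*} [CommRing A] [LieRing L] [Module A L] {q : ℕ}
    (ω : (Fin q → L) → A) : Prop :=
  (∀ (v : Fin q → L) (i : Fin q) (x y : L),
      ω (Function.update v i (x + y)) = ω (Function.update v i x) + ω (Function.update v i y)) ∧
  (∀ (v : Fin q → L) (i : Fin q) (a : A) (x : L),
      ω (Function.update v i (a • x)) = a * ω (Function.update v i x)) ∧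
  (∀ (v : Fin q → L) (i j : Fin q), i ≠ j → v i = v j → ω v = 0)

/-- A `(q, r)`-shuffle: a permutation strictly increasing on the first `q` and on the
last `r` positions. -/
def IsShuffle (q r : ℕ) (σ : Equiv.Perm (Fin (q + r))) : Prop :=
  (∀ i j : Fin (q + r), i < j → (j : ℕ) < q → σ i < σ j) ∧
  (∀ i j : Fin (q + r), i < j → q ≤ (i : ℕ) → σ i < σ j)

instance (q r : ℕ) (σ : Equiv.Perm (Fin (q + r))) : Decidable (IsShuffle q r σ) := by
  unfold IsShuffle; infer_instance

/-- Exterior (shuffle) product of a `q`-form and an `r`-form: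
`(ω ∧ θ)(z₁,…,z_{q+r}) = Σ_σ sgn σ • ω(z_{σ(1)},…,z_{σ(q)}) · θ(z_{σ(q+1)},…,z_{σ(q+r)})`,
summing over `(q,r)`-shuffles. -/
noncomputable def wedge {A L : Type*} [CommRing A] [LieRing L] [Module A L] {q r : ℕ}
    (ω : (Fin q → L) → A) (θ : (Fin r → L) → A) : (Fin (q + r) → L) → A :=
  fun z => ∑ σ : Equiv.Perm (Fin (q + r)),
    if IsShuffle q r σ then
      ((Equiv.Perm.sign σ : ℤ) •
        (ω (fun i => z (σ (Fin.castAdd r i))) * θ (fun j => z (σ (Fin.natAdd q j)))))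
    else 0

/-- Covariant Lie derivative of a `q`-form with respect to `z`. -/
def lieDer {R A L : Type*} [CommRing R] [CommRing A] [Algebra R A] [LieRing L] [Module A L]
    (P : LieRinehartPkg R A L) (z : L) {q : ℕ} (ω : (Fin q → L) → A) :
    (Fin q → L) → A :=
  fun v => P.ρ z (ω v) - ∑ i : Fin q, ω (Function.update v i ⁅z, v i⁆)

/-- Interior product: `(i_z ω)(z₂,…,z_q) = ω(z, z₂, …, z_q)`, and `i_z f = 0` on `Λ⁰`. -/
def iProd {A L : Type*} [CommRing A] [LieRing L] [Module A L] (z : L) :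
    {q : ℕ} → ((Fin q → L) → A) → (Fin (q - 1) → L) → A
  | 0, _ => fun _ => 0
  | _ + 1, ω => fun v => ω (Fin.cons z v)

/-- The argument list `(⁅v i, v j⁆, v 0, …, v̂ i, …, v̂ j, …, v q)` (meaningful for `i < j`). -/
def insOmit2 {L : Type*} [LieRing L] {q : ℕ} (v : Fin (q + 1) → L) (i j : Fin (q + 1)) :
    Fin q → L := fun k =>
  if (k : ℕ) = 0 then ⁅v i, v j⁆
  else if (k : ℕ) - 1 < (i : ℕ) then v ⟨(k : ℕ) - 1, by have := k.isLt; omega⟩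
  else if (k : ℕ) < (j : ℕ) then v ⟨(k : ℕ), by have := k.isLt; omega⟩
  else v ⟨(k : ℕ) + 1, by have := k.isLt; omega⟩

/-- Exterior differential:
`(dω)(z₀,…,z_q) = Σᵢ (−1)ⁱ ρ(zᵢ)(ω(…,ẑᵢ,…)) + Σ_{i<j} (−1)^{i+j} ω(⁅zᵢ,zⱼ⁆, …, ẑᵢ, …, ẑⱼ, …)`. -/
def extDer {R A L : Type*} [CommRing R] [CommRing A] [Algebra R A] [LieRing L] [Module A L]
    (P : LieRinehartPkg R A L) {q : ℕ} (ω : (Fin q → L) → A) :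
    (Fin (q + 1) → L) → A := fun v =>
  (∑ i : Fin (q + 1), (-1 : A) ^ (i : ℕ) * P.ρ (v i) (ω (fun k => v (i.succAbove k))))
    + ∑ i : Fin (q + 1), ∑ j : Fin (q + 1),
        if i < j then (-1 : A) ^ ((i : ℕ) + (j : ℕ)) * ω (insOmit2 v i j) else 0

/-- Pullback of forms along an `A`-linear map. -/
def pullback {A L L' : Type*} [CommRing A] [LieRing L] [LieRing L'] [Module A L] [Module A L']
    (Φ : L →ₗ[A] L') {q : ℕ} (ω : (Fin q → L') → A) : (Fin q → L) → A :=
  fun v => ω (fun i => Φ (v i))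

/-- A linear `ρ`-connection on `L`: `A`-linear in the first slot, additive in the second,
with the Leibniz rule `D x (a • u) = a • D x u + (ρ x a) • u`. -/
structure LinearConnection {R A L : Type*} [CommRing R] [CommRing A] [Algebra R A]
    [LieRing L] [Module A L] (P : LieRinehartPkg R A L) where
  D : L → L → L
  add_left : ∀ x y u : L, D (x + y) u = D x u + D y u
  smul_left : ∀ (a : A) (x u : L), D (a • x) u = a • D x u
  add_right : ∀ x u v : L, D x (u + v) = D x u + D x v
  leibniz : ∀ (x : L) (a : A) (u : L), D x (a • u) = a • D x u + (P.ρ x) a • u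

set_option linter.unusedSectionVars false

section Helpers

variable {R A L : Type*} [CommRing R] [CommRing A] [Algebra R A] [LieRing L] [Module A L]

/-- `ω` is (the underlying function of) a ℤ-multilinear alternating map. -/
def AltForm {q : ℕ} (ω : (Fin q → L) → A) : Prop :=
  ∃ f : L [⋀^Fin q]→ₗ[ℤ] A, ∀ v, f v = ω v

theorem AltForm.of_isForm {q : ℕ} {ω : (Fin q → L) → A} (h : IsForm ω) : AltForm ω := by
  obtain ⟨h1, _, h3⟩ := h
  refine ⟨{ toFun := ω, map_update_add' := ?_, map_update_smul' := ?_, map_eq_zero_of_eq' := ?_ },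
    fun v => rfl⟩
  · intro inst v i x y
    rw [Subsingleton.elim inst (instDecidableEqFin q)]
    exact h1 v i x y
  · intro inst v i c x
    rw [Subsingleton.elim inst (instDecidableEqFin q)]
    clear inst
    exact map_zsmul (AddMonoidHom.mk' (fun x => ω (Function.update v i x)) (h1 v i)) c x
  · intro v i j hv hij
    exact h3 v i j hij hv

/-- interior product -/
def iz (z : L) {q : ℕ} (ω : (Fin (q + 1) → L) → A) : (Fin q → L) → A :=
  fun v => ω (Fin.cons z v)

theorem AltForm.iz {q : ℕ} {ω : (Fin (q + 1) → L) → A} (h : AltForm ω) (z : L) :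
    AltForm (iz z ω) := by
  obtain ⟨f, hf⟩ := h
  refine ⟨f.curryLeft z, fun v => ?_⟩
  rw [_root_.iz, ← hf]; rfl

theorem AltForm.sub {q : ℕ} {ω η : (Fin q → L) → A} (h : AltForm ω) (hh : AltForm η) :
    AltForm (fun v => ω v - η v) := by
  obtain ⟨f, hf⟩ := h
  obtain ⟨g, hg⟩ := hh
  exact ⟨f - g, fun v => by simp [hf, hg]⟩

theorem AltForm.update_add {q : ℕ} {ω : (Fin q → L) → A} (h : AltForm ω)
    (v : Fin q → L) (i : Fin q) (x y : L) :
    ω (Function.update v i (x + y)) = ω (Function.update v i x) + ω (Function.update v i y) := by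
  obtain ⟨f, hf⟩ := h
  simp only [← hf, f.map_update_add]

theorem AltForm.cons_add {q : ℕ} {ω : (Fin (q + 1) → L) → A} (h : AltForm ω)
    (v : Fin q → L) (x y : L) :
    ω (Fin.cons (x + y) v) = ω (Fin.cons x v) + ω (Fin.cons y v) := by
  have := h.update_add (Fin.cons x v) 0 x y
  simpa only [Fin.update_cons_zero] using this

theorem AltForm.cons_sub {q : ℕ} {ω : (Fin (q + 1) → L) → A} (h : AltForm ω)
    (v : Fin q → L) (x y : L) :
    ω (Fin.cons (x - y) v) = ω (Fin.cons x v) - ω (Fin.cons y v) := by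
  have := h.cons_add v (x - y) y
  rw [sub_add_cancel] at this
  rw [this]; ring

theorem AltForm.cons_cons_self {q : ℕ} {ω : (Fin (q + 2) → L) → A} (h : AltForm ω)
    (v : Fin q → L) (x : L) : ω (Fin.cons x (Fin.cons x v : Fin (q + 1) → L)) = 0 := by
  obtain ⟨f, hf⟩ := h
  rw [← hf]
  exact f.map_eq_zero_of_eq _ (i := 0) (j := 1) rfl (by simp)

theorem AltForm.cons_cons_swap {q : ℕ} {ω : (Fin (q + 2) → L) → A} (h : AltForm ω)
    (v : Fin q → L) (x y : L) : ω (Fin.cons x (Fin.cons y v : Fin (q + 1) → L)) =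
      - ω (Fin.cons y (Fin.cons x v : Fin (q + 1) → L)) := by
  have h1 := h.cons_cons_self v (x + y)
  have h2 : ∀ z, ω (Fin.cons z (Fin.cons (x + y) v : Fin (q + 1) → L)) =
      ω (Fin.cons z (Fin.cons x v : Fin (q + 1) → L)) +
      ω (Fin.cons z (Fin.cons y v : Fin (q + 1) → L)) :=
    fun z => (h.iz z).cons_add v x y
  rw [h.cons_add, h2, h2, h.cons_cons_self, h.cons_cons_self] at h1
  linear_combination h1

theorem AltForm.cons_removeNth {q : ℕ} {ω : (Fin (q + 1) → L) → A} (h : AltForm ω)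
    (v : Fin (q + 1) → L) (x : L) (j : Fin (q + 1)) :
    (-1 : A) ^ (j : ℕ) * ω (Fin.cons x (fun k => v (j.succAbove k))) =
      ω (Function.update v j x) := by
  obtain ⟨f, hf⟩ := h
  have := f.map_insertNth j x (j.removeNth v)
  rw [Fin.insertNth_removeNth] at this
  rw [← hf, ← hf, this]
  simp only [Matrix.vecCons, zsmul_eq_mul, Int.cast_pow, Int.cast_neg, Int.cast_one]
  rfl

/-- Recognise alternating maps by their first slot. -/
theorem AltForm.of_cons {q : ℕ} {ω : (Fin (q + 1) → L) → A}
    (h1 : ∀ z, AltForm (_root_.iz z ω))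
    (h2 : ∀ v x y, ω (Fin.cons (x + y) v) = ω (Fin.cons x v) + ω (Fin.cons y v))
    (h3 : ∀ (v : Fin (q + 1) → L) (j : Fin q), (j : ℕ) = 0 → v 0 = v j.succ → ω v = 0) :
    AltForm ω := by
  choose f hf using h1
  let F : L →+ (L [⋀^Fin q]→ₗ[ℤ] A) := AddMonoidHom.mk' f (fun x y => by
    ext v
    simp only [AlternatingMap.add_apply, hf]
    exact h2 v x y)
  let G : MultilinearMap ℤ (fun _ : Fin (q + 1) => L) A :=
    LinearMap.uncurryLeft (M := fun _ : Fin (q + 1) => L)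
      (AlternatingMap.toMultilinearMapLM.comp F.toIntLinearMap :
        L →ₗ[ℤ] MultilinearMap ℤ (fun _ : Fin q => L) A)
  have hG : ∀ v, G v = ω v := fun v => by
    change f (v 0) (Fin.tail v) = _
    rw [hf, _root_.iz, Fin.cons_self_tail]
  have key : ∀ (v : Fin (q + 1) → L) (j : Fin q), v 0 = v j.succ → ω v = 0 := by
    intro v j hv
    have hq : 0 < q := j.pos
    let o : Fin q := ⟨0, hq⟩
    by_cases hj : j = o
    · exact h3 v j (by simp [hj, o]) hv
    · have := (f (v 0)).map_swap (Fin.tail v) (i := o) (j := j) (Ne.symm hj)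
      rw [hf, hf] at this
      have h0 : _root_.iz (v 0) ω (Fin.tail v ∘ Equiv.swap o j) = 0 := by
        refine h3 _ o rfl ?_
        simp [Fin.tail, hv]
      rw [h0] at this
      have hh : ω v = _root_.iz (v 0) ω (Fin.tail v) := by
        rw [_root_.iz, Fin.cons_self_tail]
      rw [hh]
      linear_combination this
  refine ⟨{ G with map_eq_zero_of_eq' := ?_ }, hG⟩
  intro v i j hv hij
  change G v = 0
  rw [hG]
  induction i using Fin.cases with
  | zero =>
    induction j using Fin.cases with
    | zero => exact absurd rfl hij
    | succ j => exact key v j hv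
  | succ i =>
    induction j using Fin.cases with
    | zero => exact key v i hv.symm
    | succ j =>
      have := (f (v 0)).map_eq_zero_of_eq (Fin.tail v) (i := i) (j := j) hv
        (fun h => hij (by rw [h]))
      rw [hf, _root_.iz, Fin.cons_self_tail] at this
      exact this

variable (P : LieRinehartPkg R A L)

theorem lieDer_cons (z w : L) {q : ℕ} (ω : (Fin (q + 1) → L) → A) (v : Fin q → L) :
    lieDer P z ω (Fin.cons w v) = lieDer P z (iz w ω) v - ω (Fin.cons ⁅z, w⁆ v) := by
  simp only [lieDer, Fin.sum_univ_succ, iz, Fin.cons_zero, Fin.cons_succ, Fin.update_cons_zero,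
    Fin.cons_update]
  ring

theorem iz_lieDer (z w : L) {q : ℕ} (ω : (Fin (q + 1) → L) → A) :
    iz w (lieDer P z ω) = fun v => lieDer P z (iz w ω) v - iz ⁅z, w⁆ ω v := by
  funext v; exact lieDer_cons P z w ω v

theorem lieDer_sub (z : L) {q : ℕ} (ω η : (Fin q → L) → A) (v : Fin q → L) :
    lieDer P z (fun v => ω v - η v) v = lieDer P z ω v - lieDer P z η v := by
  simp only [lieDer, map_sub, Finset.sum_sub_distrib]; ring

theorem lieDer_add (z : L) {q : ℕ} (ω η : (Fin q → L) → A) (v : Fin q → L) :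
    lieDer P z (fun v => ω v + η v) v = lieDer P z ω v + lieDer P z η v := by
  simp only [lieDer, map_add, Finset.sum_add_distrib]; ring

theorem extDer_sub {q : ℕ} (ω η : (Fin q → L) → A) (v : Fin (q + 1) → L) :
    extDer P (fun v => ω v - η v) v = extDer P ω v - extDer P η v := by
  have : ∀ i j : Fin (q + 1), (if i < j then (-1 : A) ^ ((i : ℕ) + (j : ℕ)) *
      (ω (insOmit2 v i j) - η (insOmit2 v i j)) else 0) =
      (if i < j then (-1 : A) ^ ((i : ℕ) + (j : ℕ)) * ω (insOmit2 v i j) else 0) -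
      (if i < j then (-1 : A) ^ ((i : ℕ) + (j : ℕ)) * η (insOmit2 v i j) else 0) := by
    intro i j; split_ifs <;> ring
  simp only [extDer, map_sub, mul_sub, Finset.sum_sub_distrib] at this ⊢
  simp only [this, Finset.sum_sub_distrib]; ring

theorem extDer_add {q : ℕ} (ω η : (Fin q → L) → A) (v : Fin (q + 1) → L) :
    extDer P (fun v => ω v + η v) v = extDer P ω v + extDer P η v := by
  have := extDer_sub P (fun v => ω v + η v) η v
  simp only [add_sub_cancel_right] at this
  rw [this]; ring

theorem extDer_zero_form {q : ℕ} (v : Fin (q + 1) → L) :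
    extDer P (fun _ : Fin q → L => (0 : A)) v = 0 := by
  simp [extDer]

theorem lieDer_zero_form (z : L) {q : ℕ} (v : Fin q → L) :
    lieDer P z (fun _ : Fin q → L => (0 : A)) v = 0 := by
  simp [lieDer]

theorem AltForm.lieDer_add_left {q : ℕ} {ω : (Fin q → L) → A} (h : AltForm ω) (x y : L)
    (v : Fin q → L) : lieDer P (x + y) ω v = lieDer P x ω v + lieDer P y ω v := by
  simp only [lieDer, map_add, Derivation.add_apply, add_lie, h.update_add,
    Finset.sum_add_distrib]
  ring

theorem AltForm.lieDer (z : L) {q : ℕ} {ω : (Fin q → L) → A} (h : AltForm ω) :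
    AltForm (lieDer P z ω) := by
  induction q with
  | zero =>
    refine ⟨AlternatingMap.constOfIsEmpty ℤ L (Fin 0) (_root_.lieDer P z ω Fin.elim0), ?_⟩
    intro v
    rw [Subsingleton.elim v Fin.elim0]; rfl
  | succ q ih =>
    refine AltForm.of_cons ?_ ?_ ?_
    · intro w
      rw [iz_lieDer]
      exact (ih (h.iz w)).sub (h.iz _)
    · intro v x y
      have : _root_.iz (x + y) ω = fun v => _root_.iz x ω v + _root_.iz y ω v := by
        funext v; exact h.cons_add v x y
      rw [lieDer_cons, lieDer_cons, lieDer_cons, this, _root_.lieDer_add, lie_add, h.cons_add]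
      ring
    · intro v j hj hv
      cases q with
      | zero => exact j.elim0
      | succ q =>
        obtain rfl : j = 0 := Fin.ext hj
        obtain ⟨w, v, rfl⟩ : ∃ w u, v = Fin.cons w u := ⟨_, _, (Fin.cons_self_tail v).symm⟩
        obtain ⟨w2, v, rfl⟩ : ∃ w u, v = Fin.cons w u := ⟨_, _, (Fin.cons_self_tail v).symm⟩
        simp only [Fin.cons_zero, Fin.cons_succ] at hv
        subst hv
        have h0 : _root_.iz w (_root_.iz w ω) = fun _ => 0 := by
          funext v; exact h.cons_cons_self v w
        rw [lieDer_cons, lieDer_cons, h0, lieDer_zero_form, h.cons_cons_swap v ⁅z, w⁆ w]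
        simp [_root_.iz]

theorem insOmit2_zero_succ {q : ℕ} (z : L) (v : Fin (q + 1) → L) (j : Fin (q + 1)) :
    insOmit2 (Fin.cons z v : Fin (q + 2) → L) 0 j.succ =
      Fin.cons ⁅z, v j⁆ (fun k => v (j.succAbove k)) := by
  funext k
  induction k using Fin.cases with
  | zero => simp [insOmit2]
  | succ k =>
    have e : ∀ (n : ℕ) (h : n + 1 < q + 2), (⟨n + 1, h⟩ : Fin (q + 2)) =
      Fin.succ ⟨n, by omega⟩ := fun n h => rfl
    simp only [insOmit2, Fin.cons_succ, Fin.val_succ, Fin.val_zero, e]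
    simp only [Fin.succAbove, Fin.lt_def, Fin.val_castSucc]
    split_ifs <;> first | omega | contradiction | rfl

theorem insOmit2_succ_succ {q : ℕ} (z : L) (v : Fin (q + 2) → L) (i j : Fin (q + 2)) (hij : i < j) :
    insOmit2 (Fin.cons z v : Fin (q + 3) → L) i.succ j.succ =
      Fin.cons ⁅v i, v j⁆ (Fin.cons z (Fin.tail (insOmit2 v i j)) : Fin (q + 1) → L) := by
  have e : ∀ (n : ℕ) (h : n + 1 < q + 3), (⟨n + 1, h⟩ : Fin (q + 3)) =
      Fin.succ ⟨n, by omega⟩ := fun n h => rfl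
  funext k
  induction k using Fin.cases with
  | zero => simp [insOmit2]
  | succ k =>
    induction k using Fin.cases with
    | zero => simp [insOmit2]
    | succ k =>
      simp only [insOmit2, Fin.cons_succ, Fin.val_succ, Fin.tail, e, Nat.add_sub_cancel]
      split_ifs <;> first | omega | contradiction | rfl

theorem insOmit2_eq_cons {q : ℕ} (v : Fin (q + 2) → L) (i j : Fin (q + 2)) :
    insOmit2 v i j = Fin.cons ⁅v i, v j⁆ (Fin.tail (insOmit2 v i j)) := by
  conv_lhs => rw [← Fin.cons_self_tail (insOmit2 v i j)]
  simp [insOmit2]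

/-- Cartan's magic formula. -/
theorem AltForm.cartan {q : ℕ} {ω : (Fin (q + 1) → L) → A} (h : AltForm ω) (z : L)
    (v : Fin (q + 1) → L) :
    extDer P ω (Fin.cons z v) = _root_.lieDer P z ω v - extDer P (_root_.iz z ω) v := by
  have h1 : ∀ i : Fin (q + 1),
      (fun k => (Fin.cons z v : Fin (q + 2) → L) (i.succ.succAbove k)) =
      (Fin.cons z (fun k => v (i.succAbove k)) : Fin (q + 1) → L) := by
    intro i; funext k
    induction k using Fin.cases with
    | zero => simp
    | succ k => simp
  have h2 : ∀ i j : Fin (q + 1), (if i.succ < j.succ then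
      (-1 : A) ^ ((i.succ : ℕ) + (j.succ : ℕ)) *
        ω (insOmit2 (Fin.cons z v : Fin (q + 2) → L) i.succ j.succ) else 0) =
      - (if i < j then (-1 : A) ^ ((i : ℕ) + (j : ℕ)) *
        _root_.iz z ω (insOmit2 v i j) else 0) := by
    intro i j
    simp only [Fin.succ_lt_succ_iff]
    split_ifs with hij
    · cases q with
      | zero => omega
      | succ q =>
        rw [insOmit2_succ_succ z v i j hij, insOmit2_eq_cons v i j, _root_.iz,
          h.cons_cons_swap, Fin.tail_cons]
        simp only [Fin.val_succ]
        ring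
    · simp
  have h3 : ∀ j : Fin (q + 1), (-1 : A) ^ ((j : ℕ) + 1) *
      ω (Fin.cons ⁅z, v j⁆ (fun k => v (j.succAbove k))) =
      - ω (Function.update v j ⁅z, v j⁆) := by
    intro j
    rw [← h.cons_removeNth]; ring
  have h4 : ∀ x : Fin (q + 1), (-1 : A) ^ ((x : ℕ) + 1) * P.ρ (v x)
      (ω (Fin.cons z fun k => v (x.succAbove k))) = - ((-1 : A) ^ (x : ℕ) * P.ρ (v x)
      (ω (Fin.cons z fun k => v (x.succAbove k)))) := by
    intro x; ring
  have hs1 : ∀ g : Fin (q + 2) → A, ∑ i, g i = g 0 + ∑ i : Fin (q + 1), g i.succ :=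
    fun g => Fin.sum_univ_succ g
  rw [extDer]
  simp only [hs1]
  simp only [h1, h2, insOmit2_zero_succ, extDer, _root_.lieDer]
  simp only [Fin.cons_zero, Fin.cons_succ, Fin.succ_pos, if_true, lt_self_iff_false, if_false,
    Fin.not_lt_zero, Fin.val_zero, Fin.val_succ, zero_add, h3, h4, Finset.sum_neg_distrib,
    Fin.zero_succAbove, pow_zero, one_mul, _root_.iz]
  ring

theorem extDer_deg_zero (ω : (Fin 0 → L) → A) (v : Fin 1 → L) :
    extDer P ω v = P.ρ (v 0) (ω Fin.elim0) := by
  have : ∀ w : Fin 0 → L, ω w = ω Fin.elim0 := fun w => by rw [Subsingleton.elim w Fin.elim0]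
  simp [extDer, this]

theorem AltForm.lieDer_comm (z w : L) {q : ℕ} {ω : (Fin q → L) → A} (h : AltForm ω)
    (v : Fin q → L) :
    _root_.lieDer P z (_root_.lieDer P w ω) v - _root_.lieDer P w (_root_.lieDer P z ω) v =
      _root_.lieDer P ⁅z, w⁆ ω v := by
  induction q with
  | zero => simp [_root_.lieDer, P.ρ_bracket, Derivation.commutator_apply]
  | succ q ih =>
    obtain ⟨x, v, rfl⟩ : ∃ w u, v = Fin.cons w u := ⟨_, _, (Fin.cons_self_tail v).symm⟩
    simp only [lieDer_cons, iz_lieDer, _root_.lieDer_sub]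
    rw [← ih (h.iz x), lie_lie, h.cons_sub]
    ring

theorem iz_extDer {q : ℕ} {ω : (Fin (q + 1) → L) → A} (h : AltForm ω) (z : L) :
    iz z (extDer P ω) = fun v => lieDer P z ω v - extDer P (iz z ω) v := by
  funext v; exact h.cartan P z v

theorem AltForm.extDer {q : ℕ} {ω : (Fin q → L) → A} (h : AltForm ω) :
    AltForm (extDer P ω) := by
  induction q with
  | zero =>
    refine AltForm.of_cons ?_ ?_ ?_
    · intro z
      refine ⟨AlternatingMap.constOfIsEmpty ℤ L (Fin 0) (P.ρ z (ω Fin.elim0)), ?_⟩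
      intro v
      simp [_root_.iz, extDer_deg_zero]
    · intro v x y
      simp [extDer_deg_zero]
    · intro v j; exact j.elim0
  | succ q ih =>
    have hadd : ∀ x y, _root_.iz (x + y) ω = fun v => _root_.iz x ω v + _root_.iz y ω v := by
      intro x y; funext v; exact h.cons_add v x y
    refine AltForm.of_cons ?_ ?_ ?_
    · intro z
      rw [iz_extDer P h]
      exact (h.lieDer P z).sub (ih (h.iz z))
    · intro v x y
      rw [h.cartan, h.cartan, h.cartan, h.lieDer_add_left, hadd, extDer_add]
      ring
    · intro v j hj hv
      obtain rfl : j = 0 := Fin.ext hj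
      obtain ⟨w, v, rfl⟩ : ∃ w u, v = Fin.cons w u := ⟨_, _, (Fin.cons_self_tail v).symm⟩
      obtain ⟨w2, v, rfl⟩ : ∃ w u, v = Fin.cons w u := ⟨_, _, (Fin.cons_self_tail v).symm⟩
      simp only [Fin.cons_zero, Fin.cons_succ] at hv
      subst hv
      rw [h.cartan, lieDer_cons, lie_self]
      have hz : ω (Fin.cons 0 v) = 0 := by
        have := h.cons_sub v 0 0
        simpa using this
      rw [hz]
      cases q with
      | zero =>
        rw [extDer_deg_zero]
        simp [_root_.lieDer, _root_.iz]
        rw [Subsingleton.elim v Fin.elim0, sub_self]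
      | succ q =>
        have h0 : _root_.iz w (_root_.iz w ω) = fun _ => 0 := by
          funext v; exact h.cons_cons_self v w
        rw [(h.iz w).cartan, h0, extDer_zero_form]
        ring

theorem AltForm.lieDer_extDer (z : L) {q : ℕ} {ω : (Fin q → L) → A} (h : AltForm ω)
    (v : Fin (q + 1) → L) :
    _root_.lieDer P z (_root_.extDer P ω) v = _root_.extDer P (_root_.lieDer P z ω) v := by
  induction q with
  | zero =>
    rw [extDer_deg_zero]
    simp [_root_.lieDer, extDer_deg_zero, P.ρ_bracket, Derivation.commutator_apply]
  | succ q ih =>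
    obtain ⟨w, v, rfl⟩ : ∃ w u, v = Fin.cons w u := ⟨_, _, (Fin.cons_self_tail v).symm⟩
    rw [(h.lieDer P z).cartan, lieDer_cons, iz_extDer P h, iz_lieDer, _root_.lieDer_sub,
      extDer_sub, h.cartan, ih (h.iz w), ← h.lieDer_comm P z w]
    ring

theorem AltForm.extDer_extDer {q : ℕ} {ω : (Fin q → L) → A} (h : AltForm ω)
    (v : Fin (q + 2) → L) : _root_.extDer P (_root_.extDer P ω) v = 0 := by
  induction q with
  | zero =>
    obtain ⟨w, v, rfl⟩ : ∃ w u, v = Fin.cons w u := ⟨_, _, (Fin.cons_self_tail v).symm⟩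
    rw [(h.extDer P).cartan, h.lieDer_extDer, extDer_deg_zero, extDer_deg_zero]
    simp [_root_.lieDer, _root_.iz, extDer_deg_zero]
  | succ q ih =>
    obtain ⟨w, v, rfl⟩ : ∃ w u, v = Fin.cons w u := ⟨_, _, (Fin.cons_self_tail v).symm⟩
    rw [(h.extDer P).cartan, iz_extDer P h, extDer_sub, h.lieDer_extDer, ih (h.iz w)]
    ring

end Helpers

/-- the exterior differential squares to zero: `d (dω) = 0`. -/
theorem extDer_extDer {R A L : Type*} [CommRing R] [CommRing A] [Algebra R A]
    [LieRing L] [Module A L] (P : LieRinehartPkg R A L) {q : ℕ}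
    (ω : (Fin q → L) → A) (hω : IsForm ω) (v : Fin (q + 1 + 1) → L) :
    extDer P (extDer P ω) v = 0 :=
  (AltForm.of_isForm hω).extDer_extDer P v
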